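/- Uniqueness of the optimal coefficient matrix: assume d_H ≥ rank(X). If W ∈ ℝ^{d_H×d_X} is any global minimizer of the siamese objective g, then XᵀWᵀWX = C*, where C* = λ(I_N + λXᵀX)⁻¹XᵀX is the unique EDSC minimizer; i.e., the coefficient matrix realized at any optimum of the siamese problem is unique and equals the EDSC solution. -/

import Mathlib

open Matrix BigOperators

/-- Squared Frobenius norm of a real matrix. -/
noncomputable def frobSq {m n : ℕ} (M : Matrix (Fin m) (Fin n) ℝ) : ℝ :=
  ∑ i, ∑ j, (M i j) ^ 2

/-- Siamese objective `g(W) = (1/2)‖XᵀWᵀWX‖_F² + (λ/2)‖X − X XᵀWᵀWX‖_F²`. -/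
noncomputable def siam {dX N dH : ℕ} (X : Matrix (Fin dX) (Fin N) ℝ) (lam : ℝ)
    (W : Matrix (Fin dH) (Fin dX) ℝ) : ℝ :=
  (1 / 2) * frobSq (Xᵀ * Wᵀ * W * X) +
    (lam / 2) * frobSq (X - X * (Xᵀ * Wᵀ * W * X))

theorem frobSq_eq_trace {m n : ℕ} (M : Matrix (Fin m) (Fin n) ℝ) :
    frobSq M = (Mᵀ * M).trace := by
  simp only [frobSq, trace, diag_apply, mul_apply, transpose_apply, pow_two]
  exact Finset.sum_comm

theorem frobSq_nonneg {m n : ℕ} (M : Matrix (Fin m) (Fin n) ℝ) : 0 ≤ frobSq M :=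
  Finset.sum_nonneg fun _ _ => Finset.sum_nonneg fun _ _ => sq_nonneg _

theorem eq_zero_of_frobSq_nonpos {m n : ℕ} {M : Matrix (Fin m) (Fin n) ℝ}
    (h : frobSq M ≤ 0) : M = 0 := by
  have h0 : (Mᴴ * M).trace = 0 := by
    rw [conjTranspose_eq_transpose_of_trivial, ← frobSq_eq_trace]
    exact le_antisymm h (frobSq_nonneg M)
  exact trace_conjTranspose_mul_self_eq_zero_iff.mp h0

/-- A matrix of rank at most `d` can be compressed to `d` rows preserving its Gram matrix. -/
theorem exists_gram_eq_of_rank_le {m n d : ℕ} (M : Matrix (Fin m) (Fin n) ℝ)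
    (h : M.rank ≤ d) :
    ∃ U : Matrix (Fin d) (Fin m) ℝ, (U * M)ᵀ * (U * M) = Mᵀ * M := by
  let S : Submodule ℝ (EuclideanSpace ℝ (Fin m)) := M.toEuclideanLin.range
  have hS : Module.finrank ℝ S ≤ d := by
    rwa [M.rank_eq_finrank_range_toLin (EuclideanSpace.basisFun (Fin m) ℝ).toBasis
      (EuclideanSpace.basisFun (Fin n) ℝ).toBasis, ← toEuclideanLin_eq_toLin_orthonormal] at h
  let b := stdOrthonormalBasis ℝ S
  let A : Matrix (Fin (Module.finrank ℝ S)) (Fin m) ℝ :=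
    of fun i j => (b i : EuclideanSpace ℝ (Fin m)) j
  let E : Matrix (Fin d) (Fin (Module.finrank ℝ S)) ℝ :=
    (1 : Matrix (Fin d) (Fin d) ℝ).submatrix id (Fin.castLE hS)
  have hE : Eᵀ * E = 1 := by
    ext i j
    simp [E, mul_apply, one_apply, Fin.castLE_inj]
  have hA : Aᵀ * (A * M) = M := by
    ext i j
    let v : S := ⟨M.toEuclideanLin (EuclideanSpace.single j 1), LinearMap.mem_range_self _ _⟩
    have hv : ∀ k, (v : EuclideanSpace ℝ (Fin m)) k = M k j := by
      intro k
      simp [v, toLpLin_apply]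
    have hr := congrArg (fun w : S => (w : EuclideanSpace ℝ (Fin m)) i) (b.sum_repr' v)
    simp only [hv] at hr
    rw [← hr]
    simp [A, mul_apply, PiLp.inner_apply, hv, mul_comm]
  refine ⟨E * A, ?_⟩
  calc (E * A * M)ᵀ * (E * A * M) = Mᵀ * (Aᵀ * ((Eᵀ * E) * (A * M))) := by
        simp only [transpose_mul, Matrix.mul_assoc]
    _ = Mᵀ * M := by rw [hE, Matrix.one_mul, hA]

theorem posDef_one_add_smul_transpose_mul_self {m n : ℕ} (X : Matrix (Fin m) (Fin n) ℝ)
    {lam : ℝ} (hlam : 0 < lam) : (1 + lam • (Xᵀ * X)).PosDef := by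
  refine PosDef.one.add_posSemidef (PosSemidef.smul ?_ hlam.le)
  simpa using posSemidef_conjTranspose_mul_self X

/-- Completing the square in the EDSC objective at a solution of the normal equation. -/
theorem edsc_eq_add_of_normal_eq {m n : ℕ} (X : Matrix (Fin m) (Fin n) ℝ) (lam : ℝ)
    {C₀ : Matrix (Fin n) (Fin n) ℝ} (h₀ : (1 + lam • (Xᵀ * X)) * C₀ = lam • (Xᵀ * X))
    (C : Matrix (Fin n) (Fin n) ℝ) :
    (1 / 2) * frobSq C + (lam / 2) * frobSq (X - X * C) =
      (1 / 2) * frobSq C₀ + (lam / 2) * frobSq (X - X * C₀) +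
        ((1 / 2) * frobSq (C - C₀) + (lam / 2) * frobSq (X * (C - C₀))) := by
  obtain ⟨D, rfl⟩ : ∃ D, C = C₀ + D := ⟨C - C₀, by abel⟩
  have key : ((Dᵀ * C₀).trace) = lam * ((X * D)ᵀ * (X - X * C₀)).trace := by
    have h₁ : C₀ = lam • (Xᵀ * (X - X * C₀)) := by
      rw [Matrix.add_mul, Matrix.one_mul, smul_mul, Matrix.mul_assoc] at h₀
      rw [Matrix.mul_sub, smul_sub, ← h₀]
      abel
    rw [transpose_mul, Matrix.mul_assoc, ← smul_eq_mul lam, ← trace_smul, ← Matrix.mul_smul, ← h₁]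
  have frobSq_add {p q : ℕ} (P Q : Matrix (Fin p) (Fin q) ℝ) :
      frobSq (P + Q) = frobSq P + 2 * (Qᵀ * P).trace + frobSq Q := by
    have hs : (Pᵀ * Q).trace = (Qᵀ * P).trace := by
      rw [← trace_transpose, transpose_mul, transpose_transpose]
    simp only [frobSq_eq_trace, transpose_add, Matrix.add_mul, Matrix.mul_add, trace_add, hs]
    ring
  have hX : X - X * (C₀ + D) = (X - X * C₀) + -(X * D) := by
    rw [Matrix.mul_add]; abel
  have hneg : frobSq (-(X * D)) = frobSq (X * D) := by simp [frobSq]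
  rw [hX, frobSq_add, frobSq_add, hneg, add_sub_cancel_left, transpose_neg, Matrix.neg_mul,
    trace_neg, key]
  ring

/-- If `d` is at least the rank of `X`, the normal equation of the EDSC objective has a solution
of the form `(W X)ᵀ (W X)` with `W` having `d` rows. -/
theorem exists_siamese_normal_eq {m n d : ℕ} (X : Matrix (Fin m) (Fin n) ℝ) {lam : ℝ}
    (hlam : 0 < lam) (hd : X.rank ≤ d) :
    ∃ W : Matrix (Fin d) (Fin m) ℝ,
      (1 + lam • (Xᵀ * X)) * (Xᵀ * Wᵀ * W * X) = lam • (Xᵀ * X) := by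
  have hK : (1 + lam • (X * Xᵀ)).PosDef := by
    simpa using posDef_one_add_smul_transpose_mul_self Xᵀ hlam
  obtain ⟨B, hB⟩ : ∃ B : Matrix (Fin m) (Fin m) ℝ, lam • (1 + lam • (X * Xᵀ))⁻¹ = Bᵀ * B := by
    open scoped MatrixOrder Matrix.Norms.L2Operator in
    obtain ⟨B, hB⟩ := CStarAlgebra.nonneg_iff_eq_star_mul_self.mp
      (hK.inv.posSemidef.smul hlam.le).nonneg
    exact ⟨B, by simpa [star_eq_conjTranspose] using hB⟩
  obtain ⟨U, hU⟩ := exists_gram_eq_of_rank_le (B * X) ((rank_mul_le_right B X).trans hd)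
  refine ⟨U * B, ?_⟩
  have hW : Xᵀ * (U * B)ᵀ * (U * B) * X = Xᵀ * (lam • (1 + lam • (X * Xᵀ))⁻¹) * X := by
    rw [hB]
    simpa only [transpose_mul, Matrix.mul_assoc] using hU
  have hcomm : (1 + lam • (Xᵀ * X)) * Xᵀ = Xᵀ * (1 + lam • (X * Xᵀ)) := by
    simp [Matrix.add_mul, Matrix.mul_add, Matrix.mul_assoc]
  rw [hW, ← Matrix.mul_assoc, ← Matrix.mul_assoc, hcomm, Matrix.mul_smul, Matrix.mul_assoc Xᵀ,
    mul_nonsing_inv _ ((isUnit_iff_isUnit_det _).mp hK.isUnit), Matrix.mul_one, smul_mul]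

/-- Uniqueness of the optimal coefficient matrix: if `d_H ≥ rank X` and `W` is any
global minimizer of the siamese objective, then the coefficient matrix `XᵀWᵀWX`
equals the unique EDSC minimizer `C* = λ(I + λXᵀX)⁻¹XᵀX`. -/
theorem siamese_optimal_coefficient_unique {dX N dH : ℕ}
    (X : Matrix (Fin dX) (Fin N) ℝ) (lam : ℝ) (hlam : 0 < lam)
    (hdH : X.rank ≤ dH)
    (W : Matrix (Fin dH) (Fin dX) ℝ)
    (hW : ∀ W' : Matrix (Fin dH) (Fin dX) ℝ, siam X lam W ≤ siam X lam W') :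
    Xᵀ * Wᵀ * W * X = lam • ((1 + lam • (Xᵀ * X))⁻¹ * (Xᵀ * X)) := by
  have hK := posDef_one_add_smul_transpose_mul_self X hlam
  obtain ⟨W₀, h₀⟩ := exists_siamese_normal_eq X hlam hdH
  have hle := hW W₀
  rw [siam, siam, edsc_eq_add_of_normal_eq X lam h₀ (Xᵀ * Wᵀ * W * X)] at hle
  have hXD := mul_nonneg (half_pos hlam).le
    (frobSq_nonneg (X * (Xᵀ * Wᵀ * W * X - Xᵀ * W₀ᵀ * W₀ * X)))
  have hC : Xᵀ * Wᵀ * W * X = Xᵀ * W₀ᵀ * W₀ * X :=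
    sub_eq_zero.mp (eq_zero_of_frobSq_nonpos (by linarith))
  have hinv := congrArg ((1 + lam • (Xᵀ * X))⁻¹ * ·) h₀
  rwa [nonsing_inv_mul_cancel_left _ _ ((isUnit_iff_isUnit_det _).mp hK.isUnit),
    Matrix.mul_smul, ← hC] at hinv
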